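/- Let R be an order of a number field E. The map 𝒪 ↦ (𝒪 ⊗_R R_w)_w, where 𝒪 ⊗_R R_w is identified with its image in E_w, is a bijection from the set of overorders of R onto the product, over all maximal ideals w of R, of the sets of overorders of R_w (for all but finitely many w the only overorder of R_w is R_w ⊗ ... the full integral closure, which equals R_w, so the product is essentially finite). -/

import Mathlib

open scoped Classical TensorProduct

set_option synthInstance.maxHeartbeats 1000000
set_option maxHeartbeats 1600000

noncomputable section

namespace AdicOverorder

section Completion

variable {R : Type*} [CommRing R] [IsNoetherianRing R]

lemma isUnit_algebraMap_of_notMem (w : Ideal R) [hw : w.IsMaximal] {s : R} (hs : s ∉ w) :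
    IsUnit (algebraMap R (AdicCompletion w R) s) := by
  have hc := AdicCompletion.isAdicComplete_self w w.fg_of_isNoetherianRing
  obtain ⟨t, ht⟩ := hw.exists_inv hs
  obtain ⟨i, hi, hti⟩ := ht
  have hj := IsAdicComplete.le_jacobson_bot _
    (Ideal.mem_map_of_mem (algebraMap R (AdicCompletion w R)) hi)
  have hu := Ideal.mem_jacobson_bot.1 hj (-1)
  have : algebraMap R (AdicCompletion w R) (t * s) =
      algebraMap R (AdicCompletion w R) i * -1 + 1 := by
    rw [eq_sub_of_add_eq hti, map_sub, map_one]; ring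
  rw [← this, map_mul] at hu
  exact isUnit_of_mul_isUnit_right hu

lemma exists_sub_algebraMap_mem_map_pow (w : Ideal R) (k : ℕ) (a : AdicCompletion w R) :
    ∃ r : R, a - algebraMap R _ r ∈ (w ^ k).map (algebraMap R (AdicCompletion w R)) := by
  obtain ⟨r, hr⟩ := Submodule.Quotient.mk_surjective _ (AdicCompletion.eval w R k a)
  refine ⟨r, ?_⟩
  rw [← Submodule.restrictScalars_mem R, ← Ideal.smul_top_eq_map,
    AdicCompletion.pow_smul_top_eq_ker_eval w.fg_of_isNoetherianRing, LinearMap.mem_ker, map_sub,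
    ← hr, sub_eq_zero]
  rfl

/-- Membership in a submodule can be tested after completing at every maximal ideal. -/
lemma mem_of_forall_mem_span_tmul {M : Type*} [AddCommGroup M] [Module R M] (N : Submodule R M)
    {x : M} (hx : ∀ w : Ideal R, w.IsMaximal →
      (1 : AdicCompletion w R) ⊗ₜ[R] x ∈ Submodule.span (AdicCompletion w R)
        ((fun y : M => (1 : AdicCompletion w R) ⊗ₜ[R] y) '' (N : Set M))) : x ∈ N := by
  let φ : R →ₗ[R] M ⧸ N := LinearMap.toSpanSingleton R _ (N.mkQ x)
  suffices h : LinearMap.ker φ = ⊤ by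
    have : (1 : R) ∈ LinearMap.ker φ := h ▸ Submodule.mem_top
    simpa [φ] using this
  by_contra h
  obtain ⟨w, hw, hle⟩ := Ideal.exists_le_maximal _ h
  have hzero : (1 : AdicCompletion w R) ⊗ₜ[R] N.mkQ x = 0 := by
    have hker : Submodule.span (AdicCompletion w R)
        ((fun y : M => (1 : AdicCompletion w R) ⊗ₜ[R] y) '' (N : Set M)) ≤
        LinearMap.ker (N.mkQ.baseChange (AdicCompletion w R)) := by
      rw [Submodule.span_le]
      rintro _ ⟨y, hy, rfl⟩
      have : N.mkQ y = 0 := by simpa using hy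
      rw [SetLike.mem_coe, LinearMap.mem_ker, LinearMap.baseChange_tmul, this,
        TensorProduct.tmul_zero]
    simpa using hker (hx w hw)
  have hex := Module.Flat.lTensor_exact (AdicCompletion w R)
    (LinearMap.exact_subtype_ker_map φ)
  have hone : φ.lTensor (AdicCompletion w R) (1 ⊗ₜ 1) = 0 := by simpa [φ] using hzero
  obtain ⟨z, hz⟩ := (hex _).1 hone
  let ψ : AdicCompletion w R ⊗[R] R →ₗ[R] R ⧸ w :=
    (AdicCompletion.evalOneₐ w).toLinearMap ∘ₗ (TensorProduct.rid R _).toLinearMap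
  have hψ : ψ ∘ₗ (LinearMap.ker φ).subtype.lTensor (AdicCompletion w R) = 0 := by
    ext a ⟨i, hi⟩
    have : Ideal.Quotient.mk w i = 0 := Ideal.Quotient.eq_zero_iff_mem.2 (hle hi)
    simp [ψ, Algebra.smul_def, this]
  have h1 : ψ (1 ⊗ₜ 1) = 1 := by simp [ψ]
  rw [← hz, ← LinearMap.comp_apply, hψ, LinearMap.zero_apply] at h1
  exact hw.ne_top ((Ideal.eq_top_iff_one _).2 (Ideal.Quotient.eq_zero_iff_mem.1 h1.symm))

/-- Modulo an ideal with Artinian quotient there is an element which is congruent to `1` modulo a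
power of `w` and is annihilated by that power. -/
lemma exists_one_sub_mem_pow_and_mul_mem (w I : Ideal R) [IsArtinianRing (R ⧸ I)] :
    ∃ (k : ℕ) (e : R), 1 - e ∈ w ^ (k + 1) ∧ ∀ s ∈ w ^ (k + 1), e * s ∈ I := by
  let v : Ideal (R ⧸ I) := w.map (Ideal.Quotient.mk I)
  obtain ⟨k, hk⟩ := IsArtinian.monotone_stabilizes
    (⟨fun n => OrderDual.toDual (v ^ n), fun _ _ h => Ideal.pow_le_pow_right h⟩ :
      ℕ →o (Submodule (R ⧸ I) (R ⧸ I))ᵒᵈ)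
  have hk' : v ^ k = v ^ (k + 1) := hk (k + 1) k.le_succ
  obtain ⟨j', hj', hj0⟩ := Submodule.exists_sub_one_mem_and_smul_eq_zero_of_fg_of_le_smul v (v ^ k)
    (v ^ k).fg_of_isNoetherianRing (by rw [smul_eq_mul, ← pow_succ', ← hk'])
  obtain ⟨j, hj, hjj⟩ := (Ideal.mem_map_iff_of_surjective _ Ideal.Quotient.mk_surjective).1 hj'
  have hann : ∀ s ∈ w ^ k, (j + 1) * s ∈ I := fun s hs => by
    rw [← Ideal.Quotient.eq_zero_iff_mem, map_mul, map_add, hjj, map_one, sub_add_cancel]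
    refine hj0 _ ?_
    rw [← Ideal.map_pow]
    exact Ideal.mem_map_of_mem _ hs
  refine ⟨k, 1 - (-j) ^ (k + 1), ?_, fun s hs => ?_⟩
  · rw [sub_sub_cancel]
    exact Ideal.pow_mem_pow (neg_mem hj) _
  · obtain ⟨c, hc⟩ : (j + 1) ∣ 1 - (-j) ^ (k + 1) := by
      have := sub_dvd_pow_sub_pow (1 : R) (-j) (k + 1)
      rwa [one_pow, sub_neg_eq_add, add_comm 1 j] at this
    rw [hc, mul_right_comm]
    exact I.mul_mem_right _ (hann s (Ideal.pow_le_pow_right k.le_succ hs))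

end Completion

section Subalgebra

variable {R : Type*} [CommRing R] {A : Type*} [CommRing A] [Algebra R A]

lemma adjoin_tmul_toSubmodule (S : Type*) [CommRing S] [Algebra R S] (O : Subalgebra R A) :
    Subalgebra.toSubmodule (Algebra.adjoin S ((fun x : A => (1 : S) ⊗ₜ[R] x) '' (O : Set A))) =
      Submodule.span S ((fun x : A => (1 : S) ⊗ₜ[R] x) '' (O : Set A)) := by
  rw [Algebra.adjoin_eq_span]
  congr 1
  exact congrArg SetLike.coe (Submonoid.closure_eq
    (O.toSubmonoid.map (Algebra.TensorProduct.includeRight : A →ₐ[R] S ⊗[R] A)))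

lemma mem_of_forall_mem_adjoin_tmul [IsNoetherianRing R] (O : Subalgebra R A) {x : A}
    (hx : ∀ w : Ideal R, w.IsMaximal →
      (1 : AdicCompletion w R) ⊗ₜ[R] x ∈ Algebra.adjoin (AdicCompletion w R)
        ((fun y : A => (1 : AdicCompletion w R) ⊗ₜ[R] y) '' (O : Set A))) : x ∈ O :=
  mem_of_forall_mem_span_tmul (Subalgebra.toSubmodule O) fun w hw => by
    have := hx w hw
    rwa [← Subalgebra.mem_toSubmodule, adjoin_tmul_toSubmodule] at this

/-- The elements of `A` whose image lies in every member of a family of subalgebras of the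
completions. -/
def glue (f : (w : {w : Ideal R // w.IsMaximal}) →
    Subalgebra (AdicCompletion w.1 R) (AdicCompletion w.1 R ⊗[R] A)) : Subalgebra R A :=
  ⨅ w, ((f w).restrictScalars R).comap Algebra.TensorProduct.includeRight

lemma mem_glue {f : (w : {w : Ideal R // w.IsMaximal}) →
    Subalgebra (AdicCompletion w.1 R) (AdicCompletion w.1 R ⊗[R] A)} {x : A} :
    x ∈ glue f ↔ ∀ w, (1 : AdicCompletion w.1 R) ⊗ₜ[R] x ∈ f w := by
  simp [glue, Algebra.mem_iInf]

lemma adjoin_glue [IsNoetherianRing R] (C : Subalgebra R A) (I : Ideal R) [IsArtinianRing (R ⧸ I)]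
    (hI : ∀ s ∈ I, ∀ x ∈ C, s • x ∈ (⊥ : Subalgebra R A))
    (f : (w : {w : Ideal R // w.IsMaximal}) →
      Subalgebra (AdicCompletion w.1 R) (AdicCompletion w.1 R ⊗[R] A))
    (hf : ∀ w, f w ≤ Algebra.adjoin (AdicCompletion w.1 R)
      ((fun y : A => (1 : AdicCompletion w.1 R) ⊗ₜ[R] y) '' (C : Set A)))
    (w : {w : Ideal R // w.IsMaximal}) :
    Algebra.adjoin (AdicCompletion w.1 R)
      ((fun y : A => (1 : AdicCompletion w.1 R) ⊗ₜ[R] y) '' (glue f : Set A)) = f w := by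
  refine le_antisymm (Algebra.adjoin_le ?_) fun y hy => ?_
  · rintro _ ⟨x, hx, rfl⟩
    exact mem_glue.1 hx w
  have hbot : ∀ (v : {w : Ideal R // w.IsMaximal}) (x : A), x ∈ (⊥ : Subalgebra R A) →
      (1 : AdicCompletion v.1 R) ⊗ₜ[R] x ∈
        (⊥ : Subalgebra (AdicCompletion v.1 R) (AdicCompletion v.1 R ⊗[R] A)) := by
    intro v x hx
    obtain ⟨r, rfl⟩ := Algebra.mem_bot.1 hx
    refine Algebra.mem_bot.2 ⟨algebraMap R _ r, ?_⟩
    rw [Algebra.TensorProduct.algebraMap_apply, Algebra.algebraMap_self, RingHom.id_apply,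
      Algebra.TensorProduct.tmul_one_eq_one_tmul]
  have hunit : ∀ (v : {w : Ideal R // w.IsMaximal}) (s : R) (x : A), s ∉ v.1 →
      s • x ∈ (⊥ : Subalgebra R A) → (1 : AdicCompletion v.1 R) ⊗ₜ[R] x ∈
        (⊥ : Subalgebra (AdicCompletion v.1 R) (AdicCompletion v.1 R ⊗[R] A)) := by
    intro v s x hs hx
    have := v.2
    obtain ⟨u, hu⟩ := isUnit_algebraMap_of_notMem v.1 hs
    have h := Subalgebra.smul_mem _ (hbot v _ hx) (↑u⁻¹ : AdicCompletion v.1 R)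
    have hu' : (1 : AdicCompletion v.1 R) ⊗ₜ[R] (s • x) =
        (u : AdicCompletion v.1 R) • ((1 : AdicCompletion v.1 R) ⊗ₜ[R] x) := by
      rw [TensorProduct.tmul_smul, hu, algebraMap_smul]
    rwa [hu', smul_smul, Units.inv_mul, one_smul] at h
  have hw := w.2
  obtain ⟨k, e, he, hes⟩ := exists_one_sub_mem_pow_and_mul_mem w.1 I
  have hew : e ∉ w.1 := fun h => hw.ne_top ((Ideal.eq_top_iff_one _).2 (by
    simpa using add_mem (Ideal.pow_le_self k.succ_ne_zero he) h))
  -- `w ^ (k + 1)` multiplies the completion of `C` at `w` into the completion of `R`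
  have hpow : ∀ s ∈ w.1 ^ (k + 1), ∀ x ∈ C, (1 : AdicCompletion w.1 R) ⊗ₜ[R] (s • x) ∈
      (⊥ : Subalgebra (AdicCompletion w.1 R) (AdicCompletion w.1 R ⊗[R] A)) := fun s hs x hx =>
    hunit w e _ hew (by rw [smul_smul]; exact hI _ (hes s hs) x hx)
  have happrox : ∀ z ∈ Submodule.span (AdicCompletion w.1 R)
      ((fun y : A => (1 : AdicCompletion w.1 R) ⊗ₜ[R] y) '' (C : Set A)),
      ∃ x ∈ C, z - 1 ⊗ₜ[R] (e • x) ∈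
        (⊥ : Subalgebra (AdicCompletion w.1 R) (AdicCompletion w.1 R ⊗[R] A)) := by
    intro z hz
    induction hz using Submodule.span_induction with
    | zero => exact ⟨0, zero_mem _, by simp⟩
    | add a b _ _ ha hb =>
      obtain ⟨x, hx, hax⟩ := ha
      obtain ⟨y, hy, hby⟩ := hb
      refine ⟨x + y, add_mem hx hy, ?_⟩
      rw [smul_add, TensorProduct.tmul_add, add_sub_add_comm]
      exact add_mem hax hby
    | mem z hz =>
      obtain ⟨x, hx, rfl⟩ := hz
      refine ⟨x, hx, ?_⟩
      have := hpow _ he x hx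
      rwa [sub_smul, one_smul, TensorProduct.tmul_sub] at this
    | smul a z _ ih =>
      obtain ⟨x, hx, hz⟩ := ih
      obtain ⟨r, hr⟩ := exists_sub_algebraMap_mem_map_pow w.1 (k + 1) a
      refine ⟨r • x, C.smul_mem hx r, ?_⟩
      have hsub : ∀ b ∈ (w.1 ^ (k + 1)).map (algebraMap R (AdicCompletion w.1 R)),
          b • ((1 : AdicCompletion w.1 R) ⊗ₜ[R] (e • x)) ∈
          (⊥ : Subalgebra (AdicCompletion w.1 R) (AdicCompletion w.1 R ⊗[R] A)) := by
        intro b hb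
        induction hb using Submodule.span_induction with
        | zero => rw [zero_smul]; exact zero_mem _
        | add _ _ _ _ h1 h2 => rw [add_smul]; exact add_mem h1 h2
        | smul c _ _ h => rw [smul_assoc]; exact Subalgebra.smul_mem _ h c
        | mem b hb =>
          obtain ⟨s, hs, rfl⟩ := hb
          rw [algebraMap_smul, ← TensorProduct.tmul_smul]
          exact hpow s hs _ (C.smul_mem hx e)
      have heq : a • z - 1 ⊗ₜ[R] (e • r • x) = a • (z - 1 ⊗ₜ[R] (e • x)) +
          (a - algebraMap R _ r) • ((1 : AdicCompletion w.1 R) ⊗ₜ[R] (e • x)) := by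
        rw [smul_comm e r x, TensorProduct.tmul_smul r, sub_smul, algebraMap_smul, smul_sub]
        abel
      rw [heq]
      exact add_mem (Subalgebra.smul_mem _ hz a) (hsub _ hr)
  have hyC := hf w hy
  rw [← Subalgebra.mem_toSubmodule, adjoin_tmul_toSubmodule] at hyC
  obtain ⟨x, hx, hyx⟩ := happrox y hyC
  have hmem : e • x ∈ glue f := mem_glue.2 fun v => by
    by_cases hv : v = w
    · subst hv
      simpa using sub_mem hy ((bot_le : ⊥ ≤ f v) hyx)
    · have hnot : ¬ w.1 ^ (k + 1) ≤ v.1 := fun h => by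
        have := v.2
        exact hv (Subtype.ext (hw.eq_of_le this.ne_top (this.isPrime.le_of_pow_le h)).symm)
      obtain ⟨s, hs, hsv⟩ := SetLike.not_le_iff_exists.1 hnot
      refine (bot_le : ⊥ ≤ f v) (hunit v s _ hsv ?_)
      rw [smul_smul, mul_comm]
      exact hI _ (hes s hs) x hx
  have h2 := add_mem ((bot_le : ⊥ ≤ Algebra.adjoin (AdicCompletion w.1 R)
    ((fun y : A => (1 : AdicCompletion w.1 R) ⊗ₜ[R] y) '' (glue f : Set A))) hyx)
    (Algebra.subset_adjoin ⟨_, hmem, rfl⟩)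
  simpa using h2

end Subalgebra

section Overorder

variable {E : Type*} [CommRing E]

/-- An overorder of `R`, as an `R`-subalgebra. -/
def overorder {R O : Subalgebra ℤ E} (h : R ≤ O) : Subalgebra R E :=
  { O.toSubsemiring with algebraMap_mem' := fun r => h r.2 }

lemma mem_overorder {R O : Subalgebra ℤ E} (h : R ≤ O) {x : E} : x ∈ overorder h ↔ x ∈ O :=
  Iff.rfl

lemma coe_overorder {R O : Subalgebra ℤ E} (h : R ≤ O) : (overorder h : Set E) = O :=
  rfl

end Overorder

end AdicOverorder

namespace PaperGlobal

variable (E : Type*) [Field E] [NumberField E]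

/-- An order of the number field `E`: a subring finitely generated as a `ℤ`-module
which spans `E` over `ℚ` (such a subring is automatically contained in `𝒪_E`). -/
def IsOrder (O : Subalgebra ℤ E) : Prop :=
  (Subalgebra.toSubmodule O).FG ∧ Submodule.span ℚ (O : Set E) = ⊤

/-- Fractional `R`-ideals: nonzero finitely generated `R`-submodules of `E`. -/
def FracIdeal (R : Subalgebra ℤ E) : Type _ :=
  {I : Submodule R E // I ≠ ⊥ ∧ I.FG}

/-- scaling a submodule by an element of `E` -/
def scale (R : Subalgebra ℤ E) (x : E) (I : Submodule R E) : Submodule R E :=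
  I.map (LinearMap.mulLeft (↥R) x)

/-- The ideal class monoid: fractional ideals modulo multiplication by `E^×`. -/
def ClBar (R : Subalgebra ℤ E) : Type _ :=
  Quot (fun I J : FracIdeal E R => ∃ x : E, x ≠ 0 ∧ scale E R x I.1 = J.1)

/-- multiplier ring `(I : I) = {x ∈ E | xI ⊆ I}` -/
def mult (R : Subalgebra ℤ E) (I : Submodule R E) : Set E :=
  {x : E | ∀ y ∈ I, x * y ∈ I}

/-- `cl(𝒪) = {[I] ∈ ClBar(R) | (I : I) = 𝒪}` -/
def cl (R O : Subalgebra ℤ E) : Set (ClBar E R) :=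
  {c | ∃ I : FracIdeal E R, c = Quot.mk _ I ∧ mult E R I.1 = (O : Set E)}

/-- an invertible fractional ideal: `I·J = R` for some fractional ideal `J` -/
def IsInvertible (R : Subalgebra ℤ E) (I : Submodule R E) : Prop :=
  ∃ J : Submodule R E, (J ≠ ⊥ ∧ J.FG) ∧ I * J = 1

/-- two fractional ideals lie in the same `Cl(R)`-orbit iff they differ by
multiplication by an invertible fractional ideal -/
def PicRel (R : Subalgebra ℤ E) (I J : FracIdeal E R) : Prop :=
  ∃ P : Submodule R E, (P ≠ ⊥ ∧ P.FG) ∧ IsInvertible E R P ∧ P * I.1 = J.1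

/-- the orbit space `Cl(R)∖ClBar(R)` -/
def ClQuot (R : Subalgebra ℤ E) : Type _ := Quot (PicRel E R)

/-- the image of `cl(𝒪)` in the orbit space `Cl(R)∖ClBar(R)` -/
def clQ (R O : Subalgebra ℤ E) : Set (ClQuot E R) :=
  {c | ∃ I : FracIdeal E R, c = Quot.mk _ I ∧ mult E R I.1 = (O : Set E)}

/-- the conductor `𝔣(R) = {a ∈ 𝒪_E | a𝒪_E ⊆ R}`, as a subset of `E` -/
def conductorSet (R : Subalgebra ℤ E) : Set E :=
  {a : E | a ∈ integralClosure ℤ E ∧ ∀ b ∈ integralClosure ℤ E, a * b ∈ R}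

/-- Bass order: every ideal is generated by two elements. -/
def IsBass (R : Subalgebra ℤ E) : Prop :=
  ∀ I : Ideal R, ∃ a b : R, I = Ideal.span {a, b}

/-- the `w`-adic completion `R_w` of `R` -/
abbrev Rw (R : Subalgebra ℤ E) (w : Ideal R) : Type _ := AdicCompletion w R

/-- `E_w = E ⊗_R R_w`, the total ring of fractions of `R_w` -/
abbrev Ew (R : Subalgebra ℤ E) (w : Ideal R) : Type _ := Rw E R w ⊗[↥R] E

/-- the image of a fractional `R`-ideal in `E_w`: the `R_w`-span of `1 ⊗ I` -/
def localize (R : Subalgebra ℤ E) (w : Ideal R) (I : Submodule R E) :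
    Submodule (Rw E R w) (Ew E R w) :=
  Submodule.span (Rw E R w)
    ((fun x : E => (1 : Rw E R w) ⊗ₜ[↥R] x) '' (I : Set E))

/-- scaling a submodule of `E_w` by an element of `E_w` -/
def scaleLoc (R : Subalgebra ℤ E) (w : Ideal R) (u : Ew E R w)
    (I : Submodule (Rw E R w) (Ew E R w)) : Submodule (Rw E R w) (Ew E R w) :=
  I.map (LinearMap.mulLeft (Rw E R w) u)

/-- fractional `R_w`-ideals: finitely generated `R_w`-submodules of `E_w`
containing a non-zero-divisor -/
def FracIdealLoc (R : Subalgebra ℤ E) (w : Ideal R) : Type _ :=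
  {I : Submodule (Rw E R w) (Ew E R w) //
    I.FG ∧ ∃ x ∈ I, x ∈ nonZeroDivisors (Ew E R w)}

/-- the completion `𝒪_{E_w} = 𝒪_E ⊗_R R_w` of `𝒪_E`, inside `E_w` -/
def OEw (R : Subalgebra ℤ E) (w : Ideal R) : Subalgebra (Rw E R w) (Ew E R w) :=
  Algebra.adjoin (Rw E R w)
    ((fun x : E => (1 : Rw E R w) ⊗ₜ[↥R] x) '' (integralClosure ℤ E : Set E))


section Orders

variable {E}

lemma IsOrder.moduleFinite {R : Subalgebra ℤ E} (hR : IsOrder E R) : Module.Finite ℤ R :=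
  Module.Finite.iff_fg.2 hR.1

lemma IsOrder.le_integralClosure {R : Subalgebra ℤ E} (hR : IsOrder E R) :
    R ≤ integralClosure ℤ E :=
  fun _ hx => IsIntegral.of_mem_of_fg R hR.1 _ hx

lemma integralClosure_fg : (Subalgebra.toSubmodule (integralClosure ℤ E)).FG :=
  Module.Finite.iff_fg.1 (inferInstanceAs (Module.Finite ℤ (NumberField.RingOfIntegers E)))

lemma isOrder_of_le {R O : Subalgebra ℤ E} (hR : IsOrder E R) (hRO : R ≤ O)
    (hO : O ≤ integralClosure ℤ E) : IsOrder E O := by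
  refine ⟨?_, top_le_iff.1 (hR.2.ge.trans (Submodule.span_mono hRO))⟩
  exact integralClosure_fg.of_le (Subalgebra.toSubmodule.monotone hO)

lemma IsOrder.exists_mul_mem {R : Subalgebra ℤ E} (hR : IsOrder E R) (x : E) :
    ∃ n : ℤ, n ≠ 0 ∧ (n : E) * x ∈ R := by
  have hx : x ∈ Submodule.span ℚ (R : Set E) := hR.2 ▸ Submodule.mem_top
  induction hx using Submodule.span_induction with
  | mem x hx => exact ⟨1, one_ne_zero, by simpa using hx⟩
  | zero => exact ⟨1, one_ne_zero, by simp⟩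
  | add x y _ _ hx hy =>
    obtain ⟨m, hm, hmx⟩ := hx
    obtain ⟨n, hn, hny⟩ := hy
    refine ⟨m * n, mul_ne_zero hm hn, ?_⟩
    have := add_mem (mul_mem (intCast_mem R n) hmx) (mul_mem (intCast_mem R m) hny)
    push_cast
    convert this using 1
    ring
  | smul q x _ hx =>
    obtain ⟨m, hm, hmx⟩ := hx
    refine ⟨q.den * m, mul_ne_zero (by exact_mod_cast q.den_ne_zero) hm, ?_⟩
    have := mul_mem (intCast_mem R q.num) hmx
    convert this using 1
    have hq : (q.den : E) * (q : E) = q.num := by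
      exact_mod_cast congrArg (Rat.cast : ℚ → E) q.den_mul_eq_num
    rw [Rat.smul_def, ← hq]
    push_cast
    ring

lemma IsOrder.exists_mul_integralClosure_mem {R : Subalgebra ℤ E} (hR : IsOrder E R) :
    ∃ n : ℤ, n ≠ 0 ∧ ∀ x ∈ integralClosure ℤ E, (n : E) * x ∈ R := by
  refine Submodule.fg_induction (motive := fun N _ => ∃ n : ℤ, n ≠ 0 ∧ ∀ x ∈ N, (n : E) * x ∈ R)
    (fun x => ?_) (fun M _ N _ hM hN => ?_) (Subalgebra.toSubmodule (integralClosure ℤ E))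
    integralClosure_fg
  · obtain ⟨n, hn, hnx⟩ := hR.exists_mul_mem x
    refine ⟨n, hn, fun y hy => ?_⟩
    obtain ⟨m, rfl⟩ := Submodule.mem_span_singleton.1 hy
    rw [mul_smul_comm]
    exact R.smul_mem hnx m
  · obtain ⟨m, hm, hmx⟩ := hM
    obtain ⟨n, hn, hny⟩ := hN
    refine ⟨m * n, mul_ne_zero hm hn, fun z hz => ?_⟩
    obtain ⟨x, hx, y, hy, rfl⟩ := Submodule.mem_sup.1 hz
    have := add_mem (mul_mem (intCast_mem R n) (hmx x hx)) (mul_mem (intCast_mem R m) (hny y hy))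
    push_cast
    convert this using 1
    ring

lemma IsOrder.isArtinianRing_quotient {R : Subalgebra ℤ E} (hR : IsOrder E R) {n : ℤ}
    (hn : n ≠ 0) : IsArtinianRing (R ⧸ Ideal.span {(n : R)}) := by
  have := hR.moduleFinite
  have hne : Ideal.span {(n : R)} ≠ ⊥ := by
    simpa [Ideal.span_singleton_eq_bot] using hn
  have := Ideal.finiteQuotientOfFreeOfNeBot (Ideal.span {(n : R)}) hne
  infer_instance

end Orders

/-- For an order `R` of a number field `E`, the map
`𝒪 ↦ (𝒪 ⊗_R R_w)_w` (identifying `𝒪 ⊗_R R_w` with the subring of `E_w` it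
generates over `R_w`) is a bijection from the set of AdicOverorder.overorders of `R` onto the
product, over all maximal ideals `w` of `R`, of the sets of AdicOverorder.overorders of `R_w`
(i.e. of subrings `R_w ⊆ 𝒪_w ⊆ 𝒪_{E_w}` of `E_w`). -/
theorem statement17 (R : Subalgebra ℤ E) (hR : IsOrder E R) :
    Set.BijOn
      (fun (O : Subalgebra ℤ E) (w : {w : Ideal R // w.IsMaximal}) =>
        Algebra.adjoin (Rw E R w.1)
          ((fun x : E => (1 : Rw E R w.1) ⊗ₜ[↥R] x) '' (O : Set E)))
      {O : Subalgebra ℤ E | IsOrder E O ∧ R ≤ O}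
      {f : (w : {w : Ideal R // w.IsMaximal}) → Subalgebra (Rw E R w.1) (Ew E R w.1) |
        ∀ w, f w ≤ OEw E R w.1} := by
  have := hR.moduleFinite
  have : IsNoetherianRing R := IsNoetherianRing.of_finite ℤ R
  refine ⟨fun O hO w => ?_, fun O hO O' hO' h => ?_, fun f hf => ?_⟩
  · exact Algebra.adjoin_mono (Set.image_mono hO.1.le_integralClosure)
  · have key : ∀ {O O' : Subalgebra ℤ E} (_ : R ≤ O) (_ : R ≤ O'),
        (∀ w : {w : Ideal R // w.IsMaximal},
          Algebra.adjoin (Rw E R w.1) ((fun x : E => (1 : Rw E R w.1) ⊗ₜ[↥R] x) '' (O : Set E)) =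
          Algebra.adjoin (Rw E R w.1) ((fun x : E => (1 : Rw E R w.1) ⊗ₜ[↥R] x) '' (O' : Set E))) →
        O ≤ O' := by
      intro O O' hO hO' h x hx
      rw [← AdicOverorder.mem_overorder hO']
      refine AdicOverorder.mem_of_forall_mem_adjoin_tmul _ fun w hw => ?_
      rw [AdicOverorder.coe_overorder, ← h ⟨w, hw⟩]
      exact Algebra.subset_adjoin ⟨x, hx, rfl⟩
    exact le_antisymm (key hO.2 hO'.2 (congrFun h)) (key hO'.2 hO.2 fun w => (congrFun h w).symm)
  · obtain ⟨n, hn, hnR⟩ := hR.exists_mul_integralClosure_mem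
    have := hR.isArtinianRing_quotient hn
    let C : Subalgebra R E := AdicOverorder.overorder hR.le_integralClosure
    let G : Subalgebra R E := AdicOverorder.glue f
    have hGC : G ≤ C := fun x hx => AdicOverorder.mem_of_forall_mem_adjoin_tmul C
      fun w hw => hf ⟨w, hw⟩ (AdicOverorder.mem_glue.1 hx ⟨w, hw⟩)
    have hRG : R ≤ G.restrictScalars ℤ := fun r hr => G.algebraMap_mem ⟨r, hr⟩
    refine ⟨G.restrictScalars ℤ, ⟨isOrder_of_le hR hRG hGC, hRG⟩, funext fun w => ?_⟩
    refine AdicOverorder.adjoin_glue C (Ideal.span {(n : R)}) (fun s hs x hx => ?_) f hf w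
    obtain ⟨t, rfl⟩ := Ideal.mem_span_singleton'.1 hs
    refine Algebra.mem_bot.2 ⟨⟨t * (n * x), mul_mem t.2 (hnR x hx)⟩, ?_⟩
    simp [Algebra.smul_def, mul_assoc]

end PaperGlobal
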